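/- arXiv:2211.16731 — 2 statements merged into one kernel-verified Lean document; each statement's English description precedes it below -/
import Mathlib

section
/- Let Δ̃ ∈ ℝ^{n×n} be a symmetric positive semidefinite matrix, let P = I − Δ̃, and define E(H) = tr(Hᵀ Δ̃ H) for H ∈ ℝ^{n×d}. Suppose c ≥ 0 is such that every nonzero eigenvalue λ of Δ̃ satisfies (1−λ)² ≤ c. Then for every H ∈ ℝ^{n×d}, E(P H) ≤ c · E(H). -/
open Matrix

/-- For a positive semidefinite real matrix `A`, the bound
`(1 - x)² ≤ c` at the nonzero eigenvalues gives `(1 - A) A (1 - A) ≤ c A` in the Loewner order. -/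
theorem posSemidef_smul_sub_one_sub_mul_mul_one_sub {ι : Type*} [Fintype ι] [DecidableEq ι]
    {A : Matrix ι ι ℝ} (hA : A.PosSemidef) {c : ℝ}
    (hspec : ∀ x ∈ spectrum ℝ A, x ≠ 0 → (1 - x) ^ 2 ≤ c) :
    (c • A - (1 - A) * A * (1 - A)).PosSemidef := by
  have hH := hA.isHermitian
  let φ := Unitary.conjStarAlgAut ℝ (Matrix ι ι ℝ) hH.eigenvectorUnitary
  have hφ : A = φ (diagonal hH.eigenvalues) := hH.spectral_theorem
  have key : c • A - (1 - A) * A * (1 - A) =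
      φ (diagonal fun i => (c - (1 - hH.eigenvalues i) ^ 2) * hH.eigenvalues i) := by
    have hdiag : (diagonal fun i => (c - (1 - hH.eigenvalues i) ^ 2) * hH.eigenvalues i) =
        c • diagonal hH.eigenvalues -
          (1 - diagonal hH.eigenvalues) * diagonal hH.eigenvalues *
            (1 - diagonal hH.eigenvalues) := by
      rw [← diagonal_one, diagonal_sub, diagonal_mul_diagonal, diagonal_mul_diagonal,
        ← diagonal_smul, diagonal_sub]
      congr 1
      funext i
      simp only [Pi.smul_apply, smul_eq_mul]
      ring
    rw [hdiag, map_sub, map_smul, map_mul, map_mul, map_sub, map_one, ← hφ]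
  rw [key, Unitary.conjStarAlgAut_apply]
  refine (PosSemidef.diagonal fun i => ?_).mul_mul_conjTranspose_same _
  rcases eq_or_ne (hH.eigenvalues i) 0 with h0 | h0
  · simp [h0]
  · exact mul_nonneg (sub_nonneg.2 (hspec _ (hH.eigenvalues_mem_spectrum_real i) h0))
      (hA.eigenvalues_nonneg i)

/-- The graph-propagation part of the upper bound in the layer-wise Dirichlet energy
inequality (Equation 9 of the paper): if every nonzero eigenvalue `λ` of the symmetric
positive semidefinite matrix `Δ̃` satisfies `(1−λ)² ≤ c`, then applying the propagation
matrix `P = I − Δ̃` multiplies the Dirichlet energy `E(H) = tr(Hᵀ Δ̃ H)` by at most `c`. -/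
theorem dirichlet_energy_propagation_upper_bound {n d : ℕ}
    (Lap : Matrix (Fin n) (Fin n) ℝ) (hLapSymm : Lap.IsSymm) (hLapPSD : Lap.PosSemidef)
    (c : ℝ) (hc : 0 ≤ c)
    (hspec : ∀ lam : ℝ, lam ∈ spectrum ℝ Lap → lam ≠ 0 → (1 - lam) ^ 2 ≤ c)
    (P : Matrix (Fin n) (Fin n) ℝ) (hP : P = 1 - Lap)
    (H : Matrix (Fin n) (Fin d) ℝ) :
    Matrix.trace ((P * H)ᵀ * Lap * (P * H)) ≤ c * Matrix.trace (Hᵀ * Lap * H) := by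
  have hM := (posSemidef_smul_sub_one_sub_mul_mul_one_sub hLapPSD hspec)
    |>.conjTranspose_mul_mul_same H
  have hPT : Pᵀ = 1 - Lap := by rw [hP, transpose_sub, transpose_one, hLapSymm.eq]
  have htr := hM.trace_nonneg
  rw [conjTranspose_eq_transpose_of_trivial, Matrix.mul_sub, Matrix.sub_mul, trace_sub,
    Matrix.mul_smul, Matrix.smul_mul, trace_smul, smul_eq_mul, sub_nonneg] at htr
  rw [transpose_mul, hPT, hP]
  simpa only [Matrix.mul_assoc] using htr
end

section
/- Let Δ̃ ∈ ℝ^{n×n} be a symmetric positive semidefinite matrix, let P = I − Δ̃, and define E(H) = tr(Hᵀ Δ̃ H) for H ∈ ℝ^{n×d}. Suppose c' ≥ 0 is such that every nonzero eigenvalue λ of Δ̃ satisfies (1−λ)² ≥ c'. Then for every H ∈ ℝ^{n×d}, E(P H) ≥ c' · E(H). -/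
open Matrix

/-- If every nonzero eigenvalue `x` of a positive semidefinite matrix `A` satisfies
`c ≤ (1 - x) ^ 2`, then `c • A ≤ (1 - A) * A * (1 - A)` in the Loewner order. -/
theorem Matrix.PosSemidef.one_sub_mul_self_mul_one_sub_sub_smul {ι : Type*} [Fintype ι]
    [DecidableEq ι] {A : Matrix ι ι ℝ} (hA : A.PosSemidef) {c : ℝ}
    (hc : ∀ x ∈ spectrum ℝ A, x ≠ 0 → c ≤ (1 - x) ^ 2) :
    ((1 - A) * A * (1 - A) - c • A).PosSemidef := by
  set ev := hA.isHermitian.eigenvalues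
  set φ := Unitary.conjStarAlgAut ℝ (Matrix ι ι ℝ) hA.isHermitian.eigenvectorUnitary with hφ
  have hspec : A = φ (diagonal ev) := hA.isHermitian.spectral_theorem
  have hdiag : (1 - diagonal ev) * diagonal ev * (1 - diagonal ev) - c • diagonal ev =
      diagonal fun i => ev i * ((1 - ev i) ^ 2 - c) := by
    rw [← diagonal_one, diagonal_sub, diagonal_mul_diagonal, diagonal_mul_diagonal,
      ← diagonal_smul, diagonal_sub]
    congr 1
    ext i
    simp only [Pi.smul_apply, smul_eq_mul]
    ring
  have hconj : (1 - A) * A * (1 - A) - c • A =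
      φ (diagonal fun i => ev i * ((1 - ev i) ^ 2 - c)) := by
    rw [← hdiag, map_sub, map_mul, map_mul, map_sub, map_one, map_smul, ← hspec]
  rw [hconj, hφ, Unitary.conjStarAlgAut_apply]
  refine PosSemidef.mul_mul_conjTranspose_same (PosSemidef.diagonal fun i => ?_) _
  by_cases hi : ev i = 0
  · simp [hi]
  · exact mul_nonneg (hA.eigenvalues_nonneg i)
      (sub_nonneg.2 (hc _ (hA.isHermitian.eigenvalues_mem_spectrum_real i) hi))

/-- The graph-propagation part of the lower bound in the layer-wise Dirichlet energy
inequality (Equation 9 of the paper): if every nonzero eigenvalue `λ` of the symmetric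
positive semidefinite matrix `Δ̃` satisfies `(1−λ)² ≥ c'`, then applying the propagation
matrix `P = I − Δ̃` multiplies the Dirichlet energy `E(H) = tr(Hᵀ Δ̃ H)` by at least `c'`. -/
theorem dirichlet_energy_propagation_lower_bound {n d : ℕ}
    (Lap : Matrix (Fin n) (Fin n) ℝ) (hLapSymm : Lap.IsSymm) (hLapPSD : Lap.PosSemidef)
    (c' : ℝ) (hc' : 0 ≤ c')
    (hspec : ∀ lam : ℝ, lam ∈ spectrum ℝ Lap → lam ≠ 0 → c' ≤ (1 - lam) ^ 2)
    (P : Matrix (Fin n) (Fin n) ℝ) (hP : P = 1 - Lap)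
    (H : Matrix (Fin n) (Fin d) ℝ) :
    c' * Matrix.trace (Hᵀ * Lap * H) ≤ Matrix.trace ((P * H)ᵀ * Lap * (P * H)) := by
  subst hP
  have htrace := ((hLapPSD.one_sub_mul_self_mul_one_sub_sub_smul hspec).conjTranspose_mul_mul_same
    H).trace_nonneg
  have hsplit : Hᴴ * ((1 - Lap) * Lap * (1 - Lap) - c' • Lap) * H =
      ((1 - Lap) * H)ᵀ * Lap * ((1 - Lap) * H) - c' • (Hᵀ * Lap * H) := by
    rw [conjTranspose_eq_transpose_of_trivial, transpose_mul, transpose_sub, transpose_one,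
      hLapSymm.eq, Matrix.mul_sub, Matrix.sub_mul, Matrix.mul_smul, Matrix.smul_mul]
    simp only [Matrix.mul_assoc]
  rw [hsplit, trace_sub, trace_smul, smul_eq_mul] at htrace
  exact sub_nonneg.1 htrace
end
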